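/- arXiv:2502.16149 — 9 statements merged into one kernel-verified Lean document; each statement's English description precedes it below -/
import Mathlib

section
/- Let ε ∈ {−1,0,1} (as a real number), let r > 0 with r ≤ 1 if ε ≠ 0, and let x ∈ ℝ² with |x| < r and ξ ∈ ℝ² with ξ ≠ 0. Let s > 0 be the (unique) positive real number with |x + sξ| = r and set 𝔞 = x + sξ. Then the limit lim_{t→0⁺} (1/t)·[ log(|x − 𝔞| / |x + tξ − 𝔞|) + (1/2)·log((1 + ε|x + tξ|²)/(1 + ε|x|²)) ] exists and equals F_ε(x,ξ) = √((r²−|x|²)|ξ|² + ⟨x,ξ⟩²)/(r²−|x|²) + (1+εr²)⟨x,ξ⟩/((r²−|x|²)(1+ε|x|²)). (This is the Busemann–Mayer derivation of the Funk–Finsler metric in the constant-curvature chart.) -/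
open RealInnerProductSpace

/-- The Funk term of the distance along the ray from `x` in direction `ξ`. -/
theorem log_norm_sub_div_norm_sub_of_ray {E : Type*} [NormedAddCommGroup E] [NormedSpace ℝ E]
    (x : E) {ξ : E} (hξ : ξ ≠ 0) (s t : ℝ) :
    Real.log (‖x - (x + s • ξ)‖ / ‖x + t • ξ - (x + s • ξ)‖) = Real.log (s / (s - t)) := by
  have h₁ : ‖x - (x + s • ξ)‖ = |s| * ‖ξ‖ := by
    rw [show x - (x + s • ξ) = (-s) • ξ by module, norm_smul, Real.norm_eq_abs, abs_neg]
  have h₂ : ‖x + t • ξ - (x + s • ξ)‖ = |s - t| * ‖ξ‖ := by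
    rw [show x + t • ξ - (x + s • ξ) = (-(s - t)) • ξ by module, norm_smul, Real.norm_eq_abs,
      abs_neg]
  rw [h₁, h₂, mul_div_mul_right _ _ (norm_ne_zero_iff.mpr hξ), ← abs_div, Real.log_abs]

/-- The right derivative at `0` of the distance along a ray meeting the boundary at time `s`. -/
theorem hasDerivAt_log_div_sub_add_half_log {s : ℝ} (hs : s ≠ 0) (ε a b n : ℝ)
    (ha : 1 + ε * a ≠ 0) :
    HasDerivAt
      (fun t : ℝ => Real.log (s / (s - t))
        + (1 / 2) * Real.log ((1 + ε * (a + 2 * b * t + n * t ^ 2)) / (1 + ε * a)))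
      (1 / s + ε * b / (1 + ε * a)) 0 := by
  have h₁ : HasDerivAt (fun t : ℝ => s - t) (-1) 0 := (hasDerivAt_id 0).const_sub s
  have h₂ : HasDerivAt (fun t : ℝ => 1 + ε * (a + 2 * b * t + n * t ^ 2)) (ε * (2 * b)) 0 := by
    refine HasDerivAt.congr_deriv ((((((hasDerivAt_id (0 : ℝ)).const_mul (2 * b)).const_add a).add
      (((hasDerivAt_id (0 : ℝ)).pow 2).const_mul n)).const_mul ε).const_add 1) ?_
    simp
  have h₃ := (((hasDerivAt_const (0 : ℝ) s).div h₁ (by simpa using hs)).log (by simpa using hs)).add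
    (((h₂.div_const (1 + ε * a)).log (by simpa using ha)).const_mul (1 / 2))
  refine HasDerivAt.congr_deriv h₃ ?_
  simp only [Pi.div_apply, sub_zero, mul_zero, add_zero, ne_eq, OfNat.ofNat_ne_zero,
    not_false_eq_true, zero_pow]
  field_simp
  ring

/-- The reciprocal of the positive root of `n s² + 2 b s = A`. -/
theorem one_div_eq_sqrt_div_add_div {s n b A : ℝ} (hs : 0 < s) (hn : 0 ≤ n) (hA : 0 < A)
    (h : n * s ^ 2 + 2 * b * s = A) :
    1 / s = Real.sqrt (A * n + b ^ 2) / A + b / A := by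
  have h₁ : 0 < n * s + 2 * b := by
    refine pos_of_mul_pos_right (a := s) ?_ hs.le
    linarith [show s * (n * s + 2 * b) = A by rw [← h]; ring]
  have h₂ : 0 ≤ n * s + b := by nlinarith [mul_nonneg hn hs.le]
  rw [show A * n + b ^ 2 = (n * s + b) ^ 2 by rw [← h]; ring, Real.sqrt_sq h₂]
  field_simp
  rw [← h]
  ring

/-- Busemann–Mayer derivation of the Funk–Finsler metric in the constant-curvature chart:
the one-sided limit of `d(x, x + tξ)/t` as `t → 0⁺` equals `F_ε(x, ξ)`. -/
theorem funk_finsler_busemann_mayer (ε r : ℝ) (hε : ε = -1 ∨ ε = 0 ∨ ε = 1) (hr : 0 < r)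
    (hr1 : ε ≠ 0 → r ≤ 1) (x ξ : EuclideanSpace ℝ (Fin 2)) (hx : ‖x‖ < r) (hξ : ξ ≠ 0)
    (s : ℝ) (hs : 0 < s) (hsr : ‖x + s • ξ‖ = r) :
    Filter.Tendsto
      (fun t : ℝ =>
        (1 / t) * (Real.log (‖x - (x + s • ξ)‖ / ‖x + t • ξ - (x + s • ξ)‖)
          + (1 / 2) * Real.log ((1 + ε * ‖x + t • ξ‖ ^ 2) / (1 + ε * ‖x‖ ^ 2))))
      (nhdsWithin 0 (Set.Ioi 0))
      (nhds (Real.sqrt ((r ^ 2 - ‖x‖ ^ 2) * ‖ξ‖ ^ 2 + ⟪x, ξ⟫ ^ 2) / (r ^ 2 - ‖x‖ ^ 2)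
        + (1 + ε * r ^ 2) * ⟪x, ξ⟫ / ((r ^ 2 - ‖x‖ ^ 2) * (1 + ε * ‖x‖ ^ 2)))) := by
  have hnorm (t : ℝ) : ‖x + t • ξ‖ ^ 2 = ‖x‖ ^ 2 + 2 * ⟪x, ξ⟫ * t + ‖ξ‖ ^ 2 * t ^ 2 := by
    rw [norm_add_sq_real, real_inner_smul_right, norm_smul, mul_pow, Real.norm_eq_abs, sq_abs]
    ring
  have hlt : ‖x‖ ^ 2 < r ^ 2 := by gcongr
  have hA : 0 < r ^ 2 - ‖x‖ ^ 2 := sub_pos.mpr hlt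
  have hne : 1 + ε * ‖x‖ ^ 2 ≠ 0 := by
    rcases hε with rfl | rfl | rfl
    · have := pow_le_one₀ (n := 2) hr.le (hr1 (by norm_num))
      linarith
    · simp
    · positivity
  have hroot := one_div_eq_sqrt_div_add_div (n := ‖ξ‖ ^ 2) (b := ⟪x, ξ⟫) hs (by positivity) hA
    (by rw [← hsr, hnorm]; ring)
  have hval : Real.sqrt ((r ^ 2 - ‖x‖ ^ 2) * ‖ξ‖ ^ 2 + ⟪x, ξ⟫ ^ 2) / (r ^ 2 - ‖x‖ ^ 2)
      + (1 + ε * r ^ 2) * ⟪x, ξ⟫ / ((r ^ 2 - ‖x‖ ^ 2) * (1 + ε * ‖x‖ ^ 2))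
      = 1 / s + ε * ⟪x, ξ⟫ / (1 + ε * ‖x‖ ^ 2) := by
    rw [hroot, add_assoc]
    congr 1
    field_simp
    ring
  have hderiv := (hasDerivAt_log_div_sub_add_half_log hs.ne' ε (‖x‖ ^ 2) ⟪x, ξ⟫ (‖ξ‖ ^ 2)
    hne).tendsto_slope_zero_right
  rw [hval]
  refine hderiv.congr fun t => ?_
  rw [log_norm_sub_div_norm_sub_of_ray x hξ, hnorm]
  simp [hs.ne', hne]
end

section
/- Let ε ∈ {−1,0,1}, r > 0 with r ≤ 1 if ε ≠ 0, and x = (x¹,x²) ∈ ℝ² with |x| < r. With a^{ij}(x) the entries of the matrix ((r²−|x|²)/r²)·[[r²−|x|²+(x²)², −x¹x²],[−x¹x², r²−|x|²+(x¹)²]] and b_i(x) = (1+εr²)x^i/((r²−|x|²)(1+ε|x|²)), one has Σ_{i,j} a^{ij}(x) b_i(x) b_j(x) = |x|²(1+εr²)² / (r²(1+ε|x|²)²), and this quantity is strictly less than 1. (This is the identity ‖β‖²_α = |x|²(1+εr²)²/(r²(1+ε|x|²)²) < 1, showing F_ε is a Randers metric.) -/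
open RealInnerProductSpace

/-- The α-norm of the 1-form β of the Funk–Finsler metric:
`‖β‖²_α = |x|²(1+εr²)²/(r²(1+ε|x|²)²) < 1`, so `F_ε = α + β` is a Randers metric. -/
theorem funk_finsler_beta_norm (ε r : ℝ) (hε : ε = -1 ∨ ε = 0 ∨ ε = 1) (hr : 0 < r)
    (hr1 : ε ≠ 0 → r ≤ 1) (x : EuclideanSpace ℝ (Fin 2)) (hx : ‖x‖ < r)
    (aInv : Matrix (Fin 2) (Fin 2) ℝ)
    (haInv : aInv = ((r ^ 2 - ‖x‖ ^ 2) / r ^ 2) •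
      !![r ^ 2 - ‖x‖ ^ 2 + (x 1) ^ 2, -(x 0 * x 1);
         -(x 0 * x 1), r ^ 2 - ‖x‖ ^ 2 + (x 0) ^ 2])
    (b : Fin 2 → ℝ)
    (hb : ∀ i, b i = (1 + ε * r ^ 2) * x i / ((r ^ 2 - ‖x‖ ^ 2) * (1 + ε * ‖x‖ ^ 2))) :
    (∑ i, ∑ j, aInv i j * b i * b j)
        = ‖x‖ ^ 2 * (1 + ε * r ^ 2) ^ 2 / (r ^ 2 * (1 + ε * ‖x‖ ^ 2) ^ 2) ∧
      ‖x‖ ^ 2 * (1 + ε * r ^ 2) ^ 2 / (r ^ 2 * (1 + ε * ‖x‖ ^ 2) ^ 2) < 1 := by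
  have hn : 0 ≤ ‖x‖ := norm_nonneg x
  have hns : ‖x‖ ^ 2 = x 0 ^ 2 + x 1 ^ 2 := by
    simp [EuclideanSpace.norm_sq_eq, Fin.sum_univ_two]
  have hρ : 0 < r ^ 2 - ‖x‖ ^ 2 := by nlinarith
  have hlt : ‖x‖ * r < r ^ 2 := by nlinarith
  have hbounds : 0 < 1 + ε * ‖x‖ ^ 2 ∧ 0 ≤ 1 + ε * r ^ 2 ∧ 0 < 1 - ε * (r * ‖x‖) := by
    rcases hε with rfl | rfl | rfl
    · have hr2 : r ^ 2 ≤ 1 := pow_le_one₀ hr.le (hr1 (by norm_num))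
      refine ⟨by linarith, by linarith, by nlinarith [mul_nonneg hr.le hn]⟩
    · norm_num
    · have hr2 : r ^ 2 ≤ 1 := pow_le_one₀ hr.le (hr1 (by norm_num))
      exact ⟨by positivity, by positivity, by linarith⟩
  obtain ⟨hs, hr', hrn⟩ := hbounds
  constructor
  · simp only [Fin.sum_univ_two, haInv, hb, Matrix.smul_apply, Matrix.of_apply, smul_eq_mul,
      Matrix.cons_val_zero, Matrix.cons_val_one]
    have hρ' := hρ.ne'
    have hs' := hs.ne'
    have hform : (r ^ 2 - ‖x‖ ^ 2 + x 1 ^ 2) * x 0 ^ 2 - 2 * (x 0 * x 1) * (x 0 * x 1)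
        + (r ^ 2 - ‖x‖ ^ 2 + x 0 ^ 2) * x 1 ^ 2 = (r ^ 2 - ‖x‖ ^ 2) * ‖x‖ ^ 2 := by
      rw [hns]; ring
    generalize r ^ 2 - ‖x‖ ^ 2 = ρ at *
    generalize 1 + ε * ‖x‖ ^ 2 = σ at *
    field_simp
    linear_combination (1 + ε * r ^ 2) ^ 2 * hform
  · rw [div_lt_one (by positivity), ← mul_pow, ← mul_pow]
    refine pow_lt_pow_left₀ ?_ (mul_nonneg hn hr') two_ne_zero
    linarith [mul_pos (sub_pos.2 hx) hrn]
end

section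
/- Let ε ∈ {−1,0,1}, r > 0 with r ≤ 1 if ε ≠ 0. Then for every x ∈ ℝ² with |x| < r and every ξ ∈ ℝ² with ξ ≠ 0, the Funk–Finsler metric is strictly positive: F_ε(x,ξ) = √((r²−|x|²)|ξ|² + ⟨x,ξ⟩²)/(r²−|x|²) + (1+εr²)⟨x,ξ⟩/((r²−|x|²)(1+ε|x|²)) > 0. -/
/-- The slope condition behind the positivity of `F_ε`, with `R = r²`, `s = |x|²`, `n = |ξ|²`,
`p = ⟨x, ξ⟩`. -/
lemma sq_funk_form_lt {ε R s n p : ℝ} (hε : ε = -1 ∨ ε = 0 ∨ ε = 1) (hR : ε ≠ 0 → R ≤ 1)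
    (hs : 0 ≤ s) (hsR : s < R) (hn : 0 < n) (hp : p ^ 2 ≤ s * n) :
    ((1 + ε * R) * p) ^ 2 < (1 + ε * s) ^ 2 * ((R - s) * n + p ^ 2) := by
  have hA : 0 < R - s := sub_pos.2 hsR
  rcases hε with rfl | rfl | rfl
  · have hR1 : R ≤ 1 := hR (by norm_num)
    have h1 : 0 < (1 - s) ^ 2 * ((R - s) * n) := by
      have : 0 < 1 - s := by linarith
      positivity
    have h2 : (1 - R) ^ 2 * p ^ 2 ≤ (1 - s) ^ 2 * p ^ 2 := by
      gcongr
    linarith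
  · nlinarith [mul_pos hA hn]
  · have hR1 : R ≤ 1 := hR one_ne_zero
    have hsR1 : 0 < 1 - s * R := by nlinarith
    have h1 : 0 < (R - s) * n * (1 - s * R) := by positivity
    have h2 : (R - s) * (2 + R + s) * p ^ 2 ≤ (R - s) * (2 + R + s) * (s * n) := by
      gcongr
      have : 0 < 2 + R + s := by linarith
      positivity
    linarith

open RealInnerProductSpace

/-- The Funk–Finsler metric `F_ε` is strictly positive on nonzero vectors. -/
theorem funk_finsler_positive (ε r : ℝ) (hε : ε = -1 ∨ ε = 0 ∨ ε = 1) (hr : 0 < r)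
    (hr1 : ε ≠ 0 → r ≤ 1) (x ξ : EuclideanSpace ℝ (Fin 2)) (hx : ‖x‖ < r) (hξ : ξ ≠ 0) :
    0 < Real.sqrt ((r ^ 2 - ‖x‖ ^ 2) * ‖ξ‖ ^ 2 + ⟪x, ξ⟫ ^ 2) / (r ^ 2 - ‖x‖ ^ 2)
      + (1 + ε * r ^ 2) * ⟪x, ξ⟫ / ((r ^ 2 - ‖x‖ ^ 2) * (1 + ε * ‖x‖ ^ 2)) := by
  have hsR : ‖x‖ ^ 2 < r ^ 2 := by gcongr
  have hA : 0 < r ^ 2 - ‖x‖ ^ 2 := sub_pos.2 hsR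
  have hR : ε ≠ 0 → r ^ 2 ≤ 1 := fun h => pow_le_one₀ hr.le (hr1 h)
  have hn : 0 < ‖ξ‖ ^ 2 := by positivity
  have hp : ⟪x, ξ⟫ ^ 2 ≤ ‖x‖ ^ 2 * ‖ξ‖ ^ 2 := by
    rw [← mul_pow]
    exact sq_le_sq' (neg_le_of_abs_le (abs_real_inner_le_norm x ξ)) (real_inner_le_norm x ξ)
  have hB : 0 < 1 + ε * ‖x‖ ^ 2 := by
    rcases hε with rfl | rfl | rfl
    · linarith [hR (by norm_num)]
    · norm_num
    · positivity
  have key := sq_funk_form_lt hε hR (sq_nonneg ‖x‖) hsR hn hp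
  set Q := (r ^ 2 - ‖x‖ ^ 2) * ‖ξ‖ ^ 2 + ⟪x, ξ⟫ ^ 2
  have hQ0 : 0 ≤ Q := by positivity
  rw [← Real.sq_sqrt hQ0, ← mul_pow] at key
  have hlt := (abs_lt_of_sq_lt_sq' key (by positivity)).1
  have hF : √Q / (r ^ 2 - ‖x‖ ^ 2)
      + (1 + ε * r ^ 2) * ⟪x, ξ⟫ / ((r ^ 2 - ‖x‖ ^ 2) * (1 + ε * ‖x‖ ^ 2))
      = ((1 + ε * ‖x‖ ^ 2) * √Q + (1 + ε * r ^ 2) * ⟪x, ξ⟫)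
        / ((r ^ 2 - ‖x‖ ^ 2) * (1 + ε * ‖x‖ ^ 2)) := by
    rw [add_div, mul_comm (1 + ε * ‖x‖ ^ 2) √Q, mul_div_mul_right _ _ hB.ne']
  rw [hF]
  exact div_pos (by linarith) (by positivity)
end

section
/- For x, a ∈ ℝ² define d_s(x,a) = arccos( (1 + ⟨x,a⟩) / (√(1+|x|²)·√(1+|a|²)) ). Let x ∈ ℝ², ξ ∈ ℝ² with |ξ| = 1, and 0 < t < s; set y = x + tξ and 𝔞 = x + sξ. Then sin d_s(x,𝔞) / sin d_s(y,𝔞) = (|𝔞−x|/|𝔞−y|)·√((1+|y|²)/(1+|x|²)); equivalently, log( sin d_s(x,𝔞) / sin d_s(y,𝔞) ) = log(|x−𝔞|/|y−𝔞|) + (1/2)·log((1+|y|²)/(1+|x|²)). (This expresses the spherical Papadopoulos–Yamada–Funk distance in the gnomonic chart.) -/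
open RealInnerProductSpace

/-- The spherical distance in the gnomonic chart. -/
noncomputable def sphDist (x a : EuclideanSpace ℝ (Fin 2)) : ℝ :=
  Real.arccos ((1 + ⟪x, a⟫) / (Real.sqrt (1 + ‖x‖ ^ 2) * Real.sqrt (1 + ‖a‖ ^ 2)))

/-- The sine of the spherical distance between two points of a line with unit direction `ξ`. -/
lemma sin_sphDist_add_smul (x ξ : EuclideanSpace ℝ (Fin 2)) (hξ : ‖ξ‖ = 1) {s : ℝ} (hs : 0 ≤ s) :
    Real.sin (sphDist x (x + s • ξ)) = s * Real.sqrt (1 + ‖x‖ ^ 2 - ⟪x, ξ⟫ ^ 2) /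
      (Real.sqrt (1 + ‖x‖ ^ 2) * Real.sqrt (1 + ‖x + s • ξ‖ ^ 2)) := by
  have hx : 0 < 1 + ‖x‖ ^ 2 := by positivity
  have ha : 0 < 1 + ‖x + s • ξ‖ ^ 2 := by positivity
  have hnorm : ‖x + s • ξ‖ ^ 2 = ‖x‖ ^ 2 + 2 * s * ⟪x, ξ⟫ + s ^ 2 := by
    rw [norm_add_sq_real, inner_smul_right, norm_smul, hξ, mul_one, Real.norm_eq_abs, sq_abs]
    ring
  have hinner : ⟪x, x + s • ξ⟫ = ‖x‖ ^ 2 + s * ⟪x, ξ⟫ := by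
    rw [inner_add_right, inner_smul_right, real_inner_self_eq_norm_sq]
  have hsq : 1 - ((1 + ⟪x, x + s • ξ⟫) /
      (Real.sqrt (1 + ‖x‖ ^ 2) * Real.sqrt (1 + ‖x + s • ξ‖ ^ 2))) ^ 2 =
      s ^ 2 * (1 + ‖x‖ ^ 2 - ⟪x, ξ⟫ ^ 2) / ((1 + ‖x‖ ^ 2) * (1 + ‖x + s • ξ‖ ^ 2)) := by
    rw [div_pow, mul_pow, Real.sq_sqrt hx.le, Real.sq_sqrt ha.le, eq_div_iff (by positivity),
      sub_mul, div_mul_cancel₀ _ (by positivity), hinner, hnorm]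
    ring
  rw [sphDist, Real.sin_arccos, hsq, Real.sqrt_div' _ (by positivity), Real.sqrt_mul hx.le,
    Real.sqrt_mul (sq_nonneg s), Real.sqrt_sq hs]

/-- The spherical Papadopoulos–Yamada–Funk distance in the gnomonic chart:
for collinear points `x`, `y = x + tξ`, `𝔞 = x + sξ` with `0 < t < s` and `|ξ| = 1`,
`sin d_s(x,𝔞)/sin d_s(y,𝔞) = (|𝔞−x|/|𝔞−y|)·√((1+|y|²)/(1+|x|²))`. -/
theorem pyf_distance_in_chart (x ξ : EuclideanSpace ℝ (Fin 2)) (hξ : ‖ξ‖ = 1)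
    (t s : ℝ) (ht : 0 < t) (hts : t < s)
    (y a : EuclideanSpace ℝ (Fin 2)) (hy : y = x + t • ξ) (ha : a = x + s • ξ) :
    Real.sin (sphDist x a) / Real.sin (sphDist y a)
        = (‖a - x‖ / ‖a - y‖) * Real.sqrt ((1 + ‖y‖ ^ 2) / (1 + ‖x‖ ^ 2)) ∧
      Real.log (Real.sin (sphDist x a) / Real.sin (sphDist y a))
        = Real.log (‖x - a‖ / ‖y - a‖)
          + (1 / 2) * Real.log ((1 + ‖y‖ ^ 2) / (1 + ‖x‖ ^ 2)) := by
  have hs : 0 < s := ht.trans hts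
  have hst : 0 < s - t := sub_pos.2 hts
  have hay : a = y + (s - t) • ξ := by
    rw [ha, hy, add_assoc, ← add_smul, add_sub_cancel]
  have hnorm : ‖y‖ ^ 2 = ‖x‖ ^ 2 + 2 * t * ⟪x, ξ⟫ + t ^ 2 := by
    rw [hy, norm_add_sq_real, inner_smul_right, norm_smul, hξ, mul_one, Real.norm_eq_abs, sq_abs]
    ring
  have hinner : ⟪y, ξ⟫ = ⟪x, ξ⟫ + t := by
    rw [hy, inner_add_left, real_inner_smul_left, real_inner_self_eq_norm_sq, hξ]
    ring
  have hperp : 1 + ‖y‖ ^ 2 - ⟪y, ξ⟫ ^ 2 = 1 + ‖x‖ ^ 2 - ⟪x, ξ⟫ ^ 2 := by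
    rw [hnorm, hinner]
    ring
  have hpos : 0 < 1 + ‖x‖ ^ 2 - ⟪x, ξ⟫ ^ 2 := by
    have h := sq_le_sq' (neg_le_of_abs_le (abs_real_inner_le_norm x ξ)) (real_inner_le_norm x ξ)
    rw [hξ, mul_one] at h
    linarith
  have hax : ‖a - x‖ = s := by
    rw [ha, add_sub_cancel_left, norm_smul, hξ, mul_one, Real.norm_of_nonneg hs.le]
  have hay' : ‖a - y‖ = s - t := by
    rw [hay, add_sub_cancel_left, norm_smul, hξ, mul_one, Real.norm_of_nonneg hst.le]
  have hx_pos : 0 < Real.sqrt (1 + ‖x‖ ^ 2) := by positivity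
  have hy_pos : 0 < Real.sqrt (1 + ‖y‖ ^ 2) := by positivity
  have ha_pos : 0 < Real.sqrt (1 + ‖a‖ ^ 2) := by positivity
  have hperp_pos := Real.sqrt_pos.2 hpos
  have hsin_x := sin_sphDist_add_smul x ξ hξ hs.le
  have hsin_y := sin_sphDist_add_smul y ξ hξ hst.le
  rw [← ha] at hsin_x
  rw [← hay, hperp] at hsin_y
  have hratio : Real.sin (sphDist x a) / Real.sin (sphDist y a)
      = (‖a - x‖ / ‖a - y‖) * Real.sqrt ((1 + ‖y‖ ^ 2) / (1 + ‖x‖ ^ 2)) := by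
    rw [hsin_x, hsin_y, hax, hay', Real.sqrt_div' _ (by positivity)]
    field_simp
  refine ⟨hratio, ?_⟩
  rw [hratio, norm_sub_rev x a, norm_sub_rev y a, hax, hay',
    Real.log_mul (by positivity) (by positivity), Real.log_sqrt (by positivity)]
  ring
end

section
/- Let ε ∈ {−1,0,1}, r > 0 with r ≤ 1 if ε ≠ 0, and x = (x¹,x²) ∈ ℝ² with |x| < r. Define b_i(x) = (1+εr²)x^i/((r²−|x|²)(1+ε|x|²)), Γ^k_{ij}(x) = (x^i δ_{kj} + x^j δ_{ki})/(r²−|x|²), and the covariant derivative b_{i|j}(x) = ∂b_i/∂x^j(x) − Σ_k b_k(x)Γ^k_{ij}(x). Then for all i,j ∈ {1,2}: b_{i|j}(x) = b_{j|i}(x) = ((1+εr²)/((r²−|x|²)(1+ε|x|²)))·( δ_{ij} − 2ε x^i x^j/(1+ε|x|²) ). Moreover, if 1+εr² ≠ 0 then for every x with |x| < r there exist i,j with b_{i|j}(x) ≠ 0. (Hence F_ε is a Douglas metric which is not Berwaldian.) -/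
open RealInnerProductSpace

/-- Coefficients of the 1-form β of the Funk–Finsler metric. -/
noncomputable def bCoef (ε r : ℝ) (x : EuclideanSpace ℝ (Fin 2)) (i : Fin 2) : ℝ :=
  (1 + ε * r ^ 2) * x i / ((r ^ 2 - ‖x‖ ^ 2) * (1 + ε * ‖x‖ ^ 2))

/-- Christoffel symbols of the Riemannian metric α. -/
noncomputable def christoffel (r : ℝ) (x : EuclideanSpace ℝ (Fin 2)) (k i j : Fin 2) : ℝ :=
  (x i * (if k = j then (1 : ℝ) else 0) + x j * (if k = i then (1 : ℝ) else 0))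
    / (r ^ 2 - ‖x‖ ^ 2)

/-- Covariant derivative `b_{i|j} = ∂b_i/∂x^j − Σ_k b_k Γ^k_{ij}` of β with respect to α. -/
noncomputable def bCov (ε r : ℝ) (x : EuclideanSpace ℝ (Fin 2)) (i j : Fin 2) : ℝ :=
  fderiv ℝ (fun y => bCoef ε r y i) x (EuclideanSpace.single j 1)
    - ∑ k, bCoef ε r x k * christoffel r x k i j

/-- The partial derivatives of the coefficients of `β`, away from the zeros of the denominator. -/
theorem fderiv_bCoef_single {ε r : ℝ} {x : EuclideanSpace ℝ (Fin 2)}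
    (hA : r ^ 2 - ‖x‖ ^ 2 ≠ 0) (hB : 1 + ε * ‖x‖ ^ 2 ≠ 0) (i j : Fin 2) :
    fderiv ℝ (fun y => bCoef ε r y i) x (EuclideanSpace.single j 1) =
      (1 + ε * r ^ 2) / ((r ^ 2 - ‖x‖ ^ 2) * (1 + ε * ‖x‖ ^ 2)) *
        ((if i = j then (1 : ℝ) else 0) + 2 * x i * x j / (r ^ 2 - ‖x‖ ^ 2)
          - 2 * ε * x i * x j / (1 + ε * ‖x‖ ^ 2)) := by
  have hn : HasFDerivAt (fun y : EuclideanSpace ℝ (Fin 2) => ‖y‖ ^ 2) (2 • innerSL ℝ x) x :=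
    (hasStrictFDerivAt_norm_sq x).hasFDerivAt
  have hp : HasFDerivAt (fun y : EuclideanSpace ℝ (Fin 2) => y i)
      (EuclideanSpace.proj i : EuclideanSpace ℝ (Fin 2) →L[ℝ] ℝ) x :=
    (EuclideanSpace.proj i : EuclideanSpace ℝ (Fin 2) →L[ℝ] ℝ).hasFDerivAt
  have hd := (hp.const_mul (1 + ε * r ^ 2)).mul
    ((hasDerivAt_inv (mul_ne_zero hA hB)).comp_hasFDerivAt x
      ((hn.const_sub (r ^ 2)).mul ((hn.const_mul ε).const_add 1)))
  have hb : (fun y => bCoef ε r y i) = _ := funext fun y => div_eq_mul_inv _ _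
  rw [hb]
  refine (congrArg (fun L => L (EuclideanSpace.single j 1)) hd.fderiv).trans ?_
  by_cases hij : i = j <;>
    simp [EuclideanSpace.inner_single_right, hij] <;> field_simp <;> ring

/-- The covariant derivative of `β`, away from the zeros of the denominator. -/
theorem bCov_eq {ε r : ℝ} {x : EuclideanSpace ℝ (Fin 2)}
    (hA : r ^ 2 - ‖x‖ ^ 2 ≠ 0) (hB : 1 + ε * ‖x‖ ^ 2 ≠ 0) (i j : Fin 2) :
    bCov ε r x i j =
      (1 + ε * r ^ 2) / ((r ^ 2 - ‖x‖ ^ 2) * (1 + ε * ‖x‖ ^ 2)) *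
        ((if i = j then (1 : ℝ) else 0) - 2 * ε * x i * x j / (1 + ε * ‖x‖ ^ 2)) := by
  have hs : ∑ k, bCoef ε r x k * christoffel r x k i j =
      (1 + ε * r ^ 2) / ((r ^ 2 - ‖x‖ ^ 2) * (1 + ε * ‖x‖ ^ 2)) *
        (2 * x i * x j / (r ^ 2 - ‖x‖ ^ 2)) := by
    simp only [bCoef, christoffel, mul_div_assoc', mul_add, ← Finset.sum_div, add_div,
      Finset.sum_add_distrib, mul_ite, mul_one, mul_zero, Finset.sum_ite_eq', Finset.mem_univ,
      if_true]
    field_simp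
    ring
  rw [bCov, fderiv_bCoef_single hA hB, hs]
  ring

/-- `b_{i|j} = b_{j|i} = ((1+εr²)/((r²−|x|²)(1+ε|x|²)))(δ_{ij} − 2εx^ix^j/(1+ε|x|²))`,
and if `1+εr² ≠ 0` then `b_{i|j}` does not vanish identically at any point:
`F_ε` is a non-Berwaldian Douglas metric. -/
theorem funk_finsler_bCov (ε r : ℝ) (hε : ε = -1 ∨ ε = 0 ∨ ε = 1) (hr : 0 < r)
    (hr1 : ε ≠ 0 → r ≤ 1) (x : EuclideanSpace ℝ (Fin 2)) (hx : ‖x‖ < r) :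
    (∀ i j : Fin 2,
      bCov ε r x i j = bCov ε r x j i ∧
      bCov ε r x i j
        = ((1 + ε * r ^ 2) / ((r ^ 2 - ‖x‖ ^ 2) * (1 + ε * ‖x‖ ^ 2))) *
            ((if i = j then (1 : ℝ) else 0) - 2 * ε * x i * x j / (1 + ε * ‖x‖ ^ 2))) ∧
    (1 + ε * r ^ 2 ≠ 0 → ∃ i j : Fin 2, bCov ε r x i j ≠ 0) := by
  have hx2 : ‖x‖ ^ 2 < r ^ 2 := pow_lt_pow_left₀ hx (norm_nonneg x) two_ne_zero
  have hA : r ^ 2 - ‖x‖ ^ 2 ≠ 0 := (sub_pos.mpr hx2).ne'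
  have hB : 1 + ε * ‖x‖ ^ 2 ≠ 0 := by
    rcases hε with rfl | rfl | rfl
    · have : r ^ 2 ≤ 1 := pow_le_one₀ hr.le (hr1 (by norm_num))
      linarith
    · simp
    · positivity
  refine ⟨fun i j => ⟨?_, bCov_eq hA hB i j⟩, fun hc => ?_⟩
  · rw [bCov_eq hA hB, bCov_eq hA hB]
    simp only [eq_comm (a := i) (b := j)]
    ring
  · by_contra! h
    have hfac : ∀ i j : Fin 2,
        (if i = j then (1 : ℝ) else 0) - 2 * ε * x i * x j / (1 + ε * ‖x‖ ^ 2) = 0 := by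
      intro i j
      have hij := h i j
      rw [bCov_eq hA hB] at hij
      exact (mul_eq_zero.mp hij).resolve_left (div_ne_zero hc (mul_ne_zero hA hB))
    have h00 := hfac 0 0
    have h11 := hfac 1 1
    have h01 := hfac 0 1
    simp [hB] at h00 h11 h01
    rcases h01 with (h | h) | h <;> simp [h] at h00 h11
end

section
/- Let ε ∈ {−1,0,1}, r > 0 with r ≤ 1 if ε ≠ 0. The Funk–Finsler metric F_ε(x,ξ) = √((r²−|x|²)|ξ|² + ⟨x,ξ⟩²)/(r²−|x|²) + (1+εr²)⟨x,ξ⟩/((r²−|x|²)(1+ε|x|²)) satisfies the Hamel equation for projective flatness: for every x ∈ ℝ² with |x| < r, every ξ ∈ ℝ² with ξ ≠ 0, and every ℓ ∈ {1,2}, Σ_k ξ^k · ∂²F_ε/∂x^k∂ξ^ℓ (x,ξ) = ∂F_ε/∂x^ℓ (x,ξ). (This is the analytic criterion that all geodesics of F_ε are straight line segments, i.e. F_ε is projectively flat.) -/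
open RealInnerProductSpace

/-- The Funk–Finsler metric in the constant-curvature chart. -/
noncomputable def funkF (ε r : ℝ) (x ξ : EuclideanSpace ℝ (Fin 2)) : ℝ :=
  Real.sqrt ((r ^ 2 - ‖x‖ ^ 2) * ‖ξ‖ ^ 2 + ⟪x, ξ⟫ ^ 2) / (r ^ 2 - ‖x‖ ^ 2)
    + (1 + ε * r ^ 2) * ⟪x, ξ⟫ / ((r ^ 2 - ‖x‖ ^ 2) * (1 + ε * ‖x‖ ^ 2))

theorem HasFDerivAt.div_real {E : Type*} [NormedAddCommGroup E] [NormedSpace ℝ E] {f g : E → ℝ}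
    {f' g' : E →L[ℝ] ℝ} {x : E} (hf : HasFDerivAt f f' x) (hg : HasFDerivAt g g' x)
    (hx : g x ≠ 0) :
    HasFDerivAt (fun y => f y / g y) ((g x ^ 2)⁻¹ • (g x • f' - f x • g')) x := by
  have h : HasFDerivAt (fun y => (g y)⁻¹) (-(g x ^ 2)⁻¹ • g') x :=
    (hasDerivAt_inv hx).comp_hasFDerivAt x hg
  refine (hf.mul h).congr_fderiv ?_
  ext v
  simp
  field_simp
  ring

section FunkMetric

variable {ε r : ℝ} {x ξ : EuclideanSpace ℝ (Fin 2)}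

theorem funk_radicand_pos (hx : ‖x‖ < r) (hξ : ξ ≠ 0) :
    0 < (r ^ 2 - ‖x‖ ^ 2) * ‖ξ‖ ^ 2 + ⟪x, ξ⟫ ^ 2 := by
  have hA : 0 < r ^ 2 - ‖x‖ ^ 2 := by nlinarith [norm_nonneg x]
  have hN : 0 < ‖ξ‖ := norm_pos_iff.mpr hξ
  positivity

theorem one_add_mul_norm_sq_pos (hε : ε = -1 ∨ ε = 0 ∨ ε = 1) (hr1 : ε ≠ 0 → r ≤ 1)
    (hx : ‖x‖ < r) : 0 < 1 + ε * ‖x‖ ^ 2 := by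
  rcases hε with rfl | rfl | rfl
  · have := hr1 (by norm_num)
    nlinarith [norm_nonneg x]
  · simp
  · positivity

/-- The derivative of the Funk–Finsler metric in the fibre direction `v`. -/
theorem fderiv_funkF_right (hx : ‖x‖ < r) (hξ : ξ ≠ 0) (v : EuclideanSpace ℝ (Fin 2)) :
    fderiv ℝ (fun η => funkF ε r x η) ξ v =
      ((r ^ 2 - ‖x‖ ^ 2) * ⟪ξ, v⟫ + ⟪x, ξ⟫ * ⟪x, v⟫) /
          (Real.sqrt ((r ^ 2 - ‖x‖ ^ 2) * ‖ξ‖ ^ 2 + ⟪x, ξ⟫ ^ 2) * (r ^ 2 - ‖x‖ ^ 2))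
        + (1 + ε * r ^ 2) * ⟪x, v⟫ / ((r ^ 2 - ‖x‖ ^ 2) * (1 + ε * ‖x‖ ^ 2)) := by
  have hQ := funk_radicand_pos hx hξ
  have hN : HasFDerivAt (fun η : EuclideanSpace ℝ (Fin 2) => ‖η‖ ^ 2) _ ξ :=
    (hasFDerivAt_id ξ).norm_sq
  have hI : HasFDerivAt (fun η => ⟪x, η⟫) (innerSL ℝ x) ξ := (innerSL ℝ x).hasFDerivAt
  have hS := ((hN.const_mul (r ^ 2 - ‖x‖ ^ 2)).fun_add (hI.pow 2)).sqrt hQ.ne'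
  have hF : HasFDerivAt (fun η => funkF ε r x η) _ ξ := (hS.mul_const (r ^ 2 - ‖x‖ ^ 2)⁻¹).add
    ((hI.const_mul (1 + ε * r ^ 2)).mul_const ((r ^ 2 - ‖x‖ ^ 2) * (1 + ε * ‖x‖ ^ 2))⁻¹)
  rw [hF.fderiv]
  have hSpos := Real.sqrt_pos.mpr hQ
  simp
  field_simp

/-- The derivative of the Funk–Finsler metric in the base direction `w`. -/
theorem fderiv_funkF_left (hx : ‖x‖ < r) (hB : 1 + ε * ‖x‖ ^ 2 ≠ 0) (hξ : ξ ≠ 0)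
    (w : EuclideanSpace ℝ (Fin 2)) :
    fderiv ℝ (fun y => funkF ε r y ξ) x w =
      ((⟪x, ξ⟫ * ⟪ξ, w⟫ - ⟪x, w⟫ * ‖ξ‖ ^ 2) * (r ^ 2 - ‖x‖ ^ 2)
          + 2 * ⟪x, w⟫ * ((r ^ 2 - ‖x‖ ^ 2) * ‖ξ‖ ^ 2 + ⟪x, ξ⟫ ^ 2)) /
          (Real.sqrt ((r ^ 2 - ‖x‖ ^ 2) * ‖ξ‖ ^ 2 + ⟪x, ξ⟫ ^ 2) * (r ^ 2 - ‖x‖ ^ 2) ^ 2)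
        + (1 + ε * r ^ 2) * (⟪ξ, w⟫ * ((r ^ 2 - ‖x‖ ^ 2) * (1 + ε * ‖x‖ ^ 2))
            + 2 * ⟪x, ξ⟫ * ⟪x, w⟫ * ((1 + ε * ‖x‖ ^ 2) - ε * (r ^ 2 - ‖x‖ ^ 2))) /
          ((r ^ 2 - ‖x‖ ^ 2) * (1 + ε * ‖x‖ ^ 2)) ^ 2 := by
  have hQ := funk_radicand_pos hx hξ
  have hA : r ^ 2 - ‖x‖ ^ 2 ≠ 0 := by nlinarith [norm_nonneg x]
  have hN : HasFDerivAt (fun y : EuclideanSpace ℝ (Fin 2) => ‖y‖ ^ 2) _ x :=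
    (hasFDerivAt_id x).norm_sq
  have hI : HasFDerivAt (fun y => ⟪y, ξ⟫) _ x := (hasFDerivAt_id x).inner ℝ (hasFDerivAt_const ξ x)
  have hAd := hN.const_sub (r ^ 2)
  have hBd := (hN.const_mul ε).const_add 1
  have hS := ((hAd.mul_const (‖ξ‖ ^ 2)).fun_add (hI.pow 2)).sqrt hQ.ne'
  have hF : HasFDerivAt (fun y => funkF ε r y ξ) _ x := (hS.div_real hAd hA).add
    ((hI.const_mul (1 + ε * r ^ 2)).div_real (hAd.fun_mul hBd) (mul_ne_zero hA hB))
  rw [hF.fderiv]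
  have hSpos := Real.sqrt_pos.mpr hQ
  have hsq := Real.sq_sqrt hQ.le
  simp [real_inner_comm ξ w]
  generalize √((r ^ 2 - ‖x‖ ^ 2) * ‖ξ‖ ^ 2 + ⟪x, ξ⟫ ^ 2) = S at *
  rw [← hsq]
  field_simp
  ring

/-- The derivative of the fibre derivative of the Funk–Finsler metric, along the direction `ξ`. -/
theorem fderiv_fderiv_funkF (hx : ‖x‖ < r) (hB : 1 + ε * ‖x‖ ^ 2 ≠ 0) (hξ : ξ ≠ 0)
    (v : EuclideanSpace ℝ (Fin 2)) :
    fderiv ℝ (fun y => fderiv ℝ (fun η => funkF ε r y η) ξ v) x ξ =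
      fderiv ℝ (fun y => funkF ε r y ξ) x v := by
  have hQ := funk_radicand_pos hx hξ
  have hA : r ^ 2 - ‖x‖ ^ 2 ≠ 0 := by nlinarith [norm_nonneg x]
  have hSpos := Real.sqrt_pos.mpr hQ
  have hev : (fun y => fderiv ℝ (fun η => funkF ε r y η) ξ v) =ᶠ[nhds x] fun y =>
      ((r ^ 2 - ‖y‖ ^ 2) * ⟪ξ, v⟫ + ⟪y, ξ⟫ * ⟪y, v⟫) /
          (Real.sqrt ((r ^ 2 - ‖y‖ ^ 2) * ‖ξ‖ ^ 2 + ⟪y, ξ⟫ ^ 2) * (r ^ 2 - ‖y‖ ^ 2))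
        + (1 + ε * r ^ 2) * ⟪y, v⟫ / ((r ^ 2 - ‖y‖ ^ 2) * (1 + ε * ‖y‖ ^ 2)) := by
    filter_upwards [(isOpen_lt continuous_norm continuous_const).mem_nhds hx] with y hy
    exact fderiv_funkF_right hy hξ v
  have hN : HasFDerivAt (fun y : EuclideanSpace ℝ (Fin 2) => ‖y‖ ^ 2) _ x :=
    (hasFDerivAt_id x).norm_sq
  have hI (u : EuclideanSpace ℝ (Fin 2)) : HasFDerivAt (fun y => ⟪y, u⟫) _ x :=
    (hasFDerivAt_id x).inner ℝ (hasFDerivAt_const u x)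
  have hAd := hN.const_sub (r ^ 2)
  have hBd := (hN.const_mul ε).const_add 1
  have hS := ((hAd.mul_const (‖ξ‖ ^ 2)).fun_add ((hI ξ).pow 2)).sqrt hQ.ne'
  have hF := (((hAd.mul_const ⟪ξ, v⟫).fun_add ((hI ξ).fun_mul (hI v))).div_real
      (hS.fun_mul hAd) (mul_ne_zero hSpos.ne' hA)).fun_add
    (((hI v).const_mul (1 + ε * r ^ 2)).div_real (hAd.fun_mul hBd) (mul_ne_zero hA hB))
  rw [hev.fderiv_eq, hF.fderiv, fderiv_funkF_left hx hB hξ]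
  simp
  generalize √((r ^ 2 - ‖x‖ ^ 2) * ‖ξ‖ ^ 2 + ⟪x, ξ⟫ ^ 2) = S at *
  field_simp
  ring

end FunkMetric

/-- The Funk–Finsler metric satisfies Hamel's equation
`Σ_k ξ^k ∂²F/∂x^k∂ξ^ℓ = ∂F/∂x^ℓ`, i.e. it is projectively flat. -/
theorem funk_finsler_hamel (ε r : ℝ) (hε : ε = -1 ∨ ε = 0 ∨ ε = 1) (hr : 0 < r)
    (hr1 : ε ≠ 0 → r ≤ 1) (x : EuclideanSpace ℝ (Fin 2)) (hx : ‖x‖ < r)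
    (ξ : EuclideanSpace ℝ (Fin 2)) (hξ : ξ ≠ 0) (l : Fin 2) :
    ∑ k, ξ k *
        fderiv ℝ
          (fun y => fderiv ℝ (fun η => funkF ε r y η) ξ (EuclideanSpace.single l 1))
          x (EuclideanSpace.single k 1)
      = fderiv ℝ (fun y => funkF ε r y ξ) x (EuclideanSpace.single l 1) := by
  have hξ_sum : ∑ k, ξ k • EuclideanSpace.single k (1 : ℝ) = ξ := by
    simpa using (EuclideanSpace.basisFun (Fin 2) ℝ).sum_repr ξ
  rw [← fderiv_fderiv_funkF hx (one_add_mul_norm_sq_pos hε hr1 hx).ne' hξ]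
  generalize fderiv ℝ (fun y => fderiv ℝ (fun η => funkF ε r y η) ξ _) x = L
  conv_rhs => rw [← hξ_sum]
  simp only [map_sum, map_smul, smul_eq_mul]
end

section
/- Let ε ∈ {−1,0,1}, r > 0 with r ≤ 1 if ε ≠ 0, x ∈ ℝ² with |x| < r, and ξ ∈ ℝ² with |ξ| = 1. Set α = √((r²−|x|²) + ⟨x,ξ⟩²)/(r²−|x|²) (since |ξ|=1), F = α + (1+εr²)⟨x,ξ⟩/((r²−|x|²)(1+ε|x|²)), A = (1+ε|x|²)·√((r²−|x|²) + ⟨x,ξ⟩²) + (1+εr²)⟨x,ξ⟩, φ = (1+εr²)[(1+ε|x|²) − 2ε⟨x,ξ⟩²] / ((r²−|x|²)(1+ε|x|²)²), ψ = (−2(1+εr²)⟨x,ξ⟩/((1+ε|x|²)³(r²−|x|²)²))·[(1+ε|x|²)(3εr²−2ε|x|²+1) − 2ε⟨x,ξ⟩²(1−ε|x|²+2εr²)], and define the flag curvature K = (3/4)·φ²/F⁴ − ψ/(2F³) − α²/F². Then K + 1/4 = ( 3ε(r²−|x|²)²·[1 + ε(|x|² − ⟨x,ξ⟩²)] / (4A⁴)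 ) · [ (1+εr²)(1+ε|x|²)·(√((r²−|x|²)+⟨x,ξ⟩²) + ⟨x,ξ⟩)² + A² ]. -/
open RealInnerProductSpace

/-- The polynomial form of the curvature identity, where `s` stands for the square root, `n` for
`|x|²` and `p` for `⟨x,ξ⟩`. -/
lemma funk_finsler_polynomial_identity (ε R n p s : ℝ) (hε : ε = -1 ∨ ε = 0 ∨ ε = 1)
    (hs : s ^ 2 = (R - n) + p ^ 2) :
    3 * (1 + ε * R) ^ 2 * ((1 + ε * n) - 2 * ε * p ^ 2) ^ 2 * (R - n) ^ 2
      + 4 * (1 + ε * R) * p * (R - n)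
        * ((1 + ε * n) * (3 * ε * R - 2 * ε * n + 1)
          - 2 * ε * p ^ 2 * (1 - ε * n + 2 * ε * R))
        * ((1 + ε * n) * s + (1 + ε * R) * p)
      - 4 * (1 + ε * n) ^ 2 * s ^ 2 * ((1 + ε * n) * s + (1 + ε * R) * p) ^ 2
      + ((1 + ε * n) * s + (1 + ε * R) * p) ^ 4
    = 3 * ε * (R - n) ^ 2 * (1 + ε * (n - p ^ 2))
      * ((1 + ε * R) * (1 + ε * n) * (s + p) ^ 2
        + ((1 + ε * n) * s + (1 + ε * R) * p) ^ 2) := by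
  obtain rfl : R = n + s ^ 2 - p ^ 2 := by linarith
  rcases hε with rfl | rfl | rfl <;> ring

/-- The quantity `A` is positive inside the disc. -/
lemma funk_finsler_denominator_pos (ε R n p s : ℝ) (hε : ε = -1 ∨ ε = 0 ∨ ε = 1)
    (hR : ε ≠ 0 → R ≤ 1) (hn : 0 ≤ n) (hnR : n < R) (hp : p ^ 2 ≤ n) (hs0 : 0 ≤ s)
    (hs : s ^ 2 = (R - n) + p ^ 2) :
    0 < (1 + ε * n) * s + (1 + ε * R) * p := by
  have hq : 0 < 1 + ε * n := by
    rcases hε with rfl | rfl | rfl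
    · linarith [hR (by norm_num)]
    · norm_num
    · linarith
  have key : ((1 + ε * R) * p) ^ 2 < ((1 + ε * n) * s) ^ 2 := by
    rw [mul_pow, mul_pow, hs]
    have hd : 0 < R - n := sub_pos.2 hnR
    rcases hε with rfl | rfl | rfl
    · have h1 : R ≤ 1 := hR (by norm_num)
      have h2 : (1 + -1 * R) ^ 2 ≤ (1 + -1 * n) ^ 2 :=
        pow_le_pow_left₀ (by linarith) (by linarith) 2
      have h3 := mul_le_mul_of_nonneg_right h2 (sq_nonneg p)
      have h4 := mul_pos (pow_pos hq 2) hd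
      linarith
    · linarith
    · have h1 : R ≤ 1 := hR (by norm_num)
      have h2 : (2 + R + n) * p ^ 2 ≤ (2 + R + n) * n := by gcongr; linarith
      have h3 : R * n < 1 := by nlinarith
      have h4 : (2 + R + n) * p ^ 2 < (1 + n) ^ 2 := by nlinarith
      have h5 := mul_lt_mul_of_pos_left h4 hd
      linarith
  have := (abs_lt_of_sq_lt_sq' key (by positivity)).1
  linarith

/-- The key identity for the flag curvature of the Funk–Finsler metric at a unit vector:
`K + 1/4 = (3ε(r²−|x|²)²[1+ε(|x|²−⟨x,ξ⟩²)]/(4A⁴))·[(1+εr²)(1+ε|x|²)(√((r²−|x|²)+⟨x,ξ⟩²)+⟨x,ξ⟩)² + A²]`. -/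
theorem funk_finsler_K_identity (ε r : ℝ) (hε : ε = -1 ∨ ε = 0 ∨ ε = 1) (hr : 0 < r)
    (hr1 : ε ≠ 0 → r ≤ 1) (x ξ : EuclideanSpace ℝ (Fin 2)) (hx : ‖x‖ < r) (hξ : ‖ξ‖ = 1)
    (α F A φ ψ K : ℝ)
    (hα : α = Real.sqrt ((r ^ 2 - ‖x‖ ^ 2) + ⟪x, ξ⟫ ^ 2) / (r ^ 2 - ‖x‖ ^ 2))
    (hF : F = α + (1 + ε * r ^ 2) * ⟪x, ξ⟫ / ((r ^ 2 - ‖x‖ ^ 2) * (1 + ε * ‖x‖ ^ 2)))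
    (hA : A = (1 + ε * ‖x‖ ^ 2) * Real.sqrt ((r ^ 2 - ‖x‖ ^ 2) + ⟪x, ξ⟫ ^ 2)
        + (1 + ε * r ^ 2) * ⟪x, ξ⟫)
    (hφ : φ = (1 + ε * r ^ 2) * ((1 + ε * ‖x‖ ^ 2) - 2 * ε * ⟪x, ξ⟫ ^ 2)
        / ((r ^ 2 - ‖x‖ ^ 2) * (1 + ε * ‖x‖ ^ 2) ^ 2))
    (hψ : ψ = (-2 * (1 + ε * r ^ 2) * ⟪x, ξ⟫ / ((1 + ε * ‖x‖ ^ 2) ^ 3 * (r ^ 2 - ‖x‖ ^ 2) ^ 2))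
        * ((1 + ε * ‖x‖ ^ 2) * (3 * ε * r ^ 2 - 2 * ε * ‖x‖ ^ 2 + 1)
            - 2 * ε * ⟪x, ξ⟫ ^ 2 * (1 - ε * ‖x‖ ^ 2 + 2 * ε * r ^ 2)))
    (hK : K = (3 / 4) * φ ^ 2 / F ^ 4 - ψ / (2 * F ^ 3) - α ^ 2 / F ^ 2) :
    K + 1 / 4
      = (3 * ε * (r ^ 2 - ‖x‖ ^ 2) ^ 2 * (1 + ε * (‖x‖ ^ 2 - ⟪x, ξ⟫ ^ 2)) / (4 * A ^ 4))
          * ((1 + ε * r ^ 2) * (1 + ε * ‖x‖ ^ 2)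
              * (Real.sqrt ((r ^ 2 - ‖x‖ ^ 2) + ⟪x, ξ⟫ ^ 2) + ⟪x, ξ⟫) ^ 2
            + A ^ 2) := by
  have hsub : 0 < r ^ 2 - ‖x‖ ^ 2 := by
    have := norm_nonneg x
    nlinarith
  have hp : ⟪x, ξ⟫ ^ 2 ≤ ‖x‖ ^ 2 := by
    have h := abs_real_inner_le_norm x ξ
    rw [hξ, mul_one] at h
    exact sq_le_sq.2 (by rwa [abs_of_nonneg (norm_nonneg x)])
  have hR : ε ≠ 0 → r ^ 2 ≤ 1 := fun h => pow_le_one₀ hr.le (hr1 h)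
  have hs0 := Real.sqrt_nonneg ((r ^ 2 - ‖x‖ ^ 2) + ⟪x, ξ⟫ ^ 2)
  have hs : Real.sqrt ((r ^ 2 - ‖x‖ ^ 2) + ⟪x, ξ⟫ ^ 2) ^ 2
      = (r ^ 2 - ‖x‖ ^ 2) + ⟪x, ξ⟫ ^ 2 := Real.sq_sqrt (by positivity)
  have hn := sq_nonneg ‖x‖
  generalize Real.sqrt ((r ^ 2 - ‖x‖ ^ 2) + ⟪x, ξ⟫ ^ 2) = s at *
  generalize (⟪x, ξ⟫ : ℝ) = p at *
  generalize ‖x‖ ^ 2 = n at *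
  generalize r ^ 2 = R at *
  have hApos := funk_finsler_denominator_pos ε R n p s hε hR hn (sub_pos.1 hsub) hp hs0 hs
  have hpoly := funk_finsler_polynomial_identity ε R n p s hε hs
  rw [← hA] at hApos hpoly
  have hq : 1 + ε * n ≠ 0 := by
    rcases hε with rfl | rfl | rfl
    · linarith [hR (by norm_num)]
    · norm_num
    · linarith
  have hFA : F = A / ((R - n) * (1 + ε * n)) := by
    rw [hF, hα, hA, add_div, mul_comm (1 + ε * n) s, mul_div_mul_right _ _ hq]
  have hA0 := hApos.ne'
  have hd0 := hsub.ne'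
  generalize hc : 1 + ε * R = c at *
  generalize hqq : 1 + ε * n = q at *
  generalize hdd : R - n = d at *
  generalize q * (3 * ε * R - 2 * ε * n + 1)
    - 2 * ε * p ^ 2 * (1 - ε * n + 2 * ε * R) = B at *
  rw [hK, hψ, hφ, hFA, hα]
  clear hK hψ hφ hFA hα hF hA
  have e : 3 / 4 * (c * (q - 2 * ε * p ^ 2) / (d * q ^ 2)) ^ 2 / (A / (d * q)) ^ 4
      - -2 * c * p / (q ^ 3 * d ^ 2) * B / (2 * (A / (d * q)) ^ 3)
      - (s / d) ^ 2 / (A / (d * q)) ^ 2 + 1 / 4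
      = (3 * c ^ 2 * (q - 2 * ε * p ^ 2) ^ 2 * d ^ 2 + 4 * c * p * d * B * A
        - 4 * q ^ 2 * s ^ 2 * A ^ 2 + A ^ 4) / (4 * A ^ 4) := by
    field_simp
    ring
  rw [e, hpoly]
  ring
end

section
/- Let ε ∈ {−1,0,1}, r > 0 with r ≤ 1 if ε ≠ 0, x ∈ ℝ² with |x| < r, and ξ ∈ ℝ² with ξ ≠ 0. With F_ε(x,ξ) = α(x,ξ) + β(x,ξ), α(x,ξ) = √((r²−|x|²)|ξ|² + ⟨x,ξ⟩²)/(r²−|x|²), β(x,ξ) = (1+εr²)⟨x,ξ⟩/((r²−|x|²)(1+ε|x|²)), φ(x,ξ) = (1+εr²)[(1+ε|x|²)|ξ|² − 2ε⟨x,ξ⟩²]/((r²−|x|²)(1+ε|x|²)²), ψ(x,ξ) = (−2(1+εr²)⟨x,ξ⟩/((1+ε|x|²)³(r²−|x|²)²))·[(1+ε|x|²)|ξ|²(3εr²−2ε|x|²+1) − 2ε⟨x,ξ⟩²(1−ε|x|²+2εr²)], define the flag curvature K_ε(x,ξ) = (3/4)·φ(x,ξ)²/F_ε(x,ξ)⁴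 − ψ(x,ξ)/(2F_ε(x,ξ)³) − α(x,ξ)²/F_ε(x,ξ)². Then: if ε = 0 then K_ε(x,ξ) = −1/4; if ε = −1 (hyperbolic case) then K_ε(x,ξ) < −1/4; and if ε = 1 (spherical case) then K_ε(x,ξ) > −1/4. That is, the flag curvature of the Funk–Finsler metric is bounded above by −1/4 in hyperbolic space, bounded below by −1/4 in spherical space, and identically −1/4 in the Euclidean case. -/
open RealInnerProductSpace

/-- Shifted by `1/4`, the flag curvature of the Funk–Finsler metric factors completely. Here
`R = r²`, `X = |x|²`, `N = |ξ|²`, `s = ⟨x, ξ⟩`, `D = R - X` and `A = D α`. -/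
theorem funk_flag_curvature_factorization {ε R X N s A D u c G : ℝ} (hD : D = R - X)
    (hu : u = 1 + ε * X) (hc : c = 1 + ε * R) (hG : G = u * A + c * s)
    (hA : A ^ 2 = D * N + s ^ 2) (hD0 : D ≠ 0) (hu0 : u ≠ 0) (hG0 : G ≠ 0) :
    (3 / 4) * (c * (u * N - 2 * ε * s ^ 2) / (D * u ^ 2)) ^ 2 / (A / D + c * s / (D * u)) ^ 4
      - (-2 * c * s / (u ^ 3 * D ^ 2) * (u * N * (3 * ε * R - 2 * ε * X + 1)
          - 2 * ε * s ^ 2 * (1 - ε * X + 2 * ε * R))) / (2 * (A / D + c * s / (D * u)) ^ 3)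
      - (A / D) ^ 2 / (A / D + c * s / (D * u)) ^ 2 =
    -(1 / 4) + 3 * (ε * D) * (u * A ^ 2 - c * s ^ 2)
      * ((c + u) * (u * A ^ 2 + c * s ^ 2) + 4 * c * u * A * s) / (4 * G ^ 4) := by
  have hF : A / D + c * s / (D * u) = G / (D * u) := by
    rw [hG]; field_simp
  have hc' : c = u + ε * D := by rw [hc, hu, hD]; ring
  have hN : N = (A ^ 2 - s ^ 2) / D := by rw [hA]; field_simp; ring
  have h₁ : 3 * ε * R - 2 * ε * X + 1 = u + 3 * ε * D := by rw [hu, hD]; ring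
  have h₂ : 1 - ε * X + 2 * ε * R = u + 2 * ε * D := by rw [hu, hD]; ring
  have hε : ε = (c - u) / D := by rw [hc']; field_simp; ring
  rw [hF, h₁, h₂, hN, hε]
  clear hF hN hε h₁ h₂ hA hc' hc hu hD
  field_simp
  rw [hG]
  ring

/-- The quadratic form `(c + u) (u a² + c s²) + 4 c u a s` is positive definite in `(a, s)`. -/
theorem add_mul_sq_add_pos {c u a s : ℝ} (hc : 0 ≤ c) (hu : 0 < u) (hcu : c ≠ u)
    (ha : 0 < a) : 0 < (c + u) * (u * a ^ 2 + c * s ^ 2) + 4 * c * u * a * s := by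
  have h : (c + u) * ((c + u) * (u * a ^ 2 + c * s ^ 2) + 4 * c * u * a * s) =
      c * ((c + u) * s + 2 * u * a) ^ 2 + u * (c - u) ^ 2 * a ^ 2 := by ring
  have : 0 < (c - u) ^ 2 := by have := sub_ne_zero.2 hcu; positivity
  have : 0 < c * ((c + u) * s + 2 * u * a) ^ 2 + u * (c - u) ^ 2 * a ^ 2 := by positivity
  rw [← h] at this
  exact pos_of_mul_pos_right this (by positivity)

/-- The flag curvature of the Funk–Finsler metric equals `−1/4` in the Euclidean case,
is `< −1/4` in the hyperbolic case, and is `> −1/4` in the spherical case. -/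
theorem funk_finsler_K_bounds (ε r : ℝ) (hε : ε = -1 ∨ ε = 0 ∨ ε = 1) (hr : 0 < r)
    (hr1 : ε ≠ 0 → r ≤ 1) (x ξ : EuclideanSpace ℝ (Fin 2)) (hx : ‖x‖ < r) (hξ : ξ ≠ 0)
    (α F φ ψ K : ℝ)
    (hα : α = Real.sqrt ((r ^ 2 - ‖x‖ ^ 2) * ‖ξ‖ ^ 2 + ⟪x, ξ⟫ ^ 2) / (r ^ 2 - ‖x‖ ^ 2))
    (hF : F = α + (1 + ε * r ^ 2) * ⟪x, ξ⟫ / ((r ^ 2 - ‖x‖ ^ 2) * (1 + ε * ‖x‖ ^ 2)))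
    (hφ : φ = (1 + ε * r ^ 2) * ((1 + ε * ‖x‖ ^ 2) * ‖ξ‖ ^ 2 - 2 * ε * ⟪x, ξ⟫ ^ 2)
        / ((r ^ 2 - ‖x‖ ^ 2) * (1 + ε * ‖x‖ ^ 2) ^ 2))
    (hψ : ψ = (-2 * (1 + ε * r ^ 2) * ⟪x, ξ⟫ / ((1 + ε * ‖x‖ ^ 2) ^ 3 * (r ^ 2 - ‖x‖ ^ 2) ^ 2))
        * ((1 + ε * ‖x‖ ^ 2) * ‖ξ‖ ^ 2 * (3 * ε * r ^ 2 - 2 * ε * ‖x‖ ^ 2 + 1)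
            - 2 * ε * ⟪x, ξ⟫ ^ 2 * (1 - ε * ‖x‖ ^ 2 + 2 * ε * r ^ 2)))
    (hK : K = (3 / 4) * φ ^ 2 / F ^ 4 - ψ / (2 * F ^ 3) - α ^ 2 / F ^ 2) :
    (ε = 0 → K = -(1 / 4)) ∧
    (ε = -1 → K < -(1 / 4)) ∧
    (ε = 1 → K > -(1 / 4)) := by
  have hx0 := norm_nonneg x
  have hN : 0 < ‖ξ‖ ^ 2 := by have := norm_pos_iff.2 hξ; positivity
  have hCS : ⟪x, ξ⟫ ^ 2 ≤ ‖x‖ ^ 2 * ‖ξ‖ ^ 2 := by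
    rw [← mul_pow]; exact sq_le_sq' (neg_le_of_abs_le (abs_real_inner_le_norm x ξ))
      (real_inner_le_norm x ξ)
  have hX0 : 0 ≤ ‖x‖ ^ 2 := by positivity
  have hXR : ‖x‖ ^ 2 < r ^ 2 := by gcongr
  have hR1 : ε ≠ 0 → r ^ 2 ≤ 1 := fun h => pow_le_one₀ hr.le (hr1 h)
  generalize ⟪x, ξ⟫ = s at *
  generalize ‖x‖ ^ 2 = X at *
  generalize ‖ξ‖ ^ 2 = N at *
  generalize r ^ 2 = R at *
  have hD : 0 < R - X := by linarith
  have hA2 : 0 < (R - X) * N + s ^ 2 := by positivity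
  obtain ⟨A, hAdef⟩ : ∃ A, A = √((R - X) * N + s ^ 2) := ⟨_, rfl⟩
  have hA : 0 < A := hAdef ▸ Real.sqrt_pos.2 hA2
  have hAsq : A ^ 2 = (R - X) * N + s ^ 2 := hAdef ▸ Real.sq_sqrt hA2.le
  rw [← hAdef] at hα
  have hsR : s ^ 2 * R ≤ X * A ^ 2 := by rw [hAsq]; nlinarith
  have hR : 0 < R := by linarith
  have hu : 0 < 1 + ε * X := by
    rcases hε with rfl | rfl | rfl
    · linarith [hR1 (by norm_num)]
    · norm_num
    · linarith
  have hc : 0 ≤ 1 + ε * R := by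
    rcases hε with rfl | rfl | rfl
    · linarith [hR1 (by norm_num)]
    · norm_num
    · linarith
  have hA2' : 0 < A ^ 2 := by positivity
  have hfactor : 0 < (1 + ε * X) * A ^ 2 - (1 + ε * R) * s ^ 2 := by
    have h₁ := mul_le_mul_of_nonneg_left hsR hc
    have h₂ := mul_pos hD hA2'
    refine pos_of_mul_pos_right (a := R) ?_ hR.le
    linarith
  have hG : 0 < (1 + ε * X) * A + (1 + ε * R) * s := by
    have hlt : ((1 + ε * R) * s) ^ 2 < ((1 + ε * X) * A) ^ 2 := by
      have h₁ := mul_le_mul_of_nonneg_left hsR (sq_nonneg (1 + ε * R))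
      have h₂ : 0 < (R - X) * (1 - ε ^ 2 * (R * X)) := by
        refine mul_pos hD ?_
        by_cases h : ε = 0
        · simp [h]
        · have hε2 : ε ^ 2 = 1 := by rcases hε with rfl | rfl | rfl <;> simp_all
          have hRX : R * X < 1 :=
            mul_lt_one_of_nonneg_of_lt_one_right (hR1 h) hX0 (hXR.trans_le (hR1 h))
          rw [hε2]; linarith
      have h₃ := mul_pos h₂ hA2'
      refine lt_of_mul_lt_mul_left (a := R) ?_ hR.le
      linarith
    have := (abs_lt_of_sq_lt_sq' hlt (by positivity)).1
    linarith
  have key := funk_flag_curvature_factorization (ε := ε) rfl rfl rfl rfl hAsq hD.ne' hu.ne' hG.ne'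
  rw [← hα, ← hF, ← hφ, ← hψ, ← hK] at key
  have hpos : ε ≠ 0 → 0 < 3 * (R - X) * ((1 + ε * X) * A ^ 2 - (1 + ε * R) * s ^ 2)
      * (((1 + ε * R) + (1 + ε * X)) * ((1 + ε * X) * A ^ 2 + (1 + ε * R) * s ^ 2)
        + 4 * (1 + ε * R) * (1 + ε * X) * A * s)
      / (4 * ((1 + ε * X) * A + (1 + ε * R) * s) ^ 4) := by
    intro h
    have hne : 1 + ε * R ≠ 1 + ε * X := fun h' =>
      hXR.ne' (mul_left_cancel₀ h (add_left_cancel h'))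
    have := add_mul_sq_add_pos (s := s) hc hu hne hA
    positivity
  have hK' : K = -(1 / 4) + ε * (3 * (R - X) * ((1 + ε * X) * A ^ 2 - (1 + ε * R) * s ^ 2)
      * (((1 + ε * R) + (1 + ε * X)) * ((1 + ε * X) * A ^ 2 + (1 + ε * R) * s ^ 2)
        + 4 * (1 + ε * R) * (1 + ε * X) * A * s)
      / (4 * ((1 + ε * X) * A + (1 + ε * R) * s) ^ 4)) := by
    rw [key]; ring
  generalize 3 * (R - X) * _ * _ / _ = Q at hpos hK'
  refine ⟨fun h => ?_, fun h => ?_, fun h => ?_⟩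
  · rw [hK', h]; ring
  · have := hpos (by rw [h]; norm_num)
    rw [hK', h]; linarith
  · have := hpos (by rw [h]; norm_num)
    rw [hK', h]; linarith
end

section
/- Let ε ∈ {−1,0,1}, r > 0 with r ≤ 1 if ε ≠ 0, and x = (x¹,x²) ∈ ℝ² with |x| < r. With a_{ij}(x) = ((r²−|x|²)δ_{ij} + x^ix^j)/(r²−|x|²)², b_i(x) = (1+εr²)x^i/((r²−|x|²)(1+ε|x|²)), and c(x) = (r²−|x|²)(1−ε²r²|x|²)/(r²(1+ε|x|²)²), the Zermelo navigation data of the Randers metric F_ε = α + β satisfies, for all i,j ∈ {1,2}: (i) c(x)·( a_{ij}(x) − b_i(x)b_j(x) ) = h_{ij}(x), where h_{ij}(x) = ((1−ε²r²|x|²)/(r²(1+ε|x|²)⁴))·[ δ_{ij}(1+ε|x|²)² − εx^ix^j(2 + εr² + ε|x|²) ]; and (ii) with W^i(x) = (1+εr²)(1+ε|x|²)x^i/(1−ε²r²|x|²), one has Σ_{i,j} h_{ij}(x)W^i(x)W^j(x) = |x|²(1+εr²)²/(r²(1+ε|x|²)²) (i.e. ‖W‖²_h = ‖β‖²_α). 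-/
open RealInnerProductSpace

/-- If `r ≤ 1` whenever `ε ≠ 0`, the denominators of the Funk–Finsler data are positive on the
disc of squared radius `r ^ 2`. -/
theorem funk_denominators_pos {ε r s : ℝ} (hε : ε = -1 ∨ ε = 0 ∨ ε = 1) (hr : 0 < r)
    (hr1 : ε ≠ 0 → r ≤ 1) (hs : 0 ≤ s) (hsr : s < r ^ 2) :
    0 < 1 + ε * s ∧ 0 < 1 - ε ^ 2 * r ^ 2 * s := by
  by_cases h0 : ε = 0
  · simp [h0]
  have hr2 : r ^ 2 ≤ 1 := pow_le_one₀ hr.le (hr1 h0)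
  rcases hε with rfl | rfl | rfl
  · constructor <;> nlinarith
  · exact absurd rfl h0
  · constructor <;> nlinarith

/-- Zermelo navigation data of the Funk–Finsler Randers metric:
`h_{ij} = c(a_{ij} − b_ib_j)` has the stated closed form, and the wind `W` satisfies
`‖W‖²_h = ‖β‖²_α`. -/
theorem funk_finsler_zermelo (ε r : ℝ) (hε : ε = -1 ∨ ε = 0 ∨ ε = 1) (hr : 0 < r)
    (hr1 : ε ≠ 0 → r ≤ 1) (x : EuclideanSpace ℝ (Fin 2)) (hx : ‖x‖ < r)
    (a : Fin 2 → Fin 2 → ℝ) (b : Fin 2 → ℝ) (c : ℝ) (h : Fin 2 → Fin 2 → ℝ) (W : Fin 2 → ℝ)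
    (ha : ∀ i j, a i j =
      ((r ^ 2 - ‖x‖ ^ 2) * (if i = j then (1 : ℝ) else 0) + x i * x j) / (r ^ 2 - ‖x‖ ^ 2) ^ 2)
    (hb : ∀ i, b i = (1 + ε * r ^ 2) * x i / ((r ^ 2 - ‖x‖ ^ 2) * (1 + ε * ‖x‖ ^ 2)))
    (hc : c = (r ^ 2 - ‖x‖ ^ 2) * (1 - ε ^ 2 * r ^ 2 * ‖x‖ ^ 2) / (r ^ 2 * (1 + ε * ‖x‖ ^ 2) ^ 2))
    (hh : ∀ i j, h i j = ((1 - ε ^ 2 * r ^ 2 * ‖x‖ ^ 2) / (r ^ 2 * (1 + ε * ‖x‖ ^ 2) ^ 4)) *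
      ((if i = j then (1 : ℝ) else 0) * (1 + ε * ‖x‖ ^ 2) ^ 2
        - ε * x i * x j * (2 + ε * r ^ 2 + ε * ‖x‖ ^ 2)))
    (hW : ∀ i, W i = (1 + ε * r ^ 2) * (1 + ε * ‖x‖ ^ 2) * x i
        / (1 - ε ^ 2 * r ^ 2 * ‖x‖ ^ 2)) :
    (∀ i j, c * (a i j - b i * b j) = h i j) ∧
    (∑ i, ∑ j, h i j * W i * W j)
      = ‖x‖ ^ 2 * (1 + ε * r ^ 2) ^ 2 / (r ^ 2 * (1 + ε * ‖x‖ ^ 2) ^ 2) := by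
  have hnorm : ‖x‖ ^ 2 = x 0 ^ 2 + x 1 ^ 2 := by
    rw [EuclideanSpace.real_norm_sq_eq, Fin.sum_univ_two]
  have hsr : ‖x‖ ^ 2 < r ^ 2 := pow_lt_pow_left₀ hx (norm_nonneg x) two_ne_zero
  obtain ⟨hQ, hM⟩ := funk_denominators_pos hε hr hr1 (sq_nonneg ‖x‖) hsr
  have hP : 0 < r ^ 2 - ‖x‖ ^ 2 := sub_pos.mpr hsr
  generalize ‖x‖ ^ 2 = s at *
  have hQ' := hQ.ne'
  have hM' := hM.ne'
  have hP' := hP.ne'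
  have hr' := hr.ne'
  constructor
  · intro i j
    rw [hc, ha, hb, hb, hh]
    generalize (if i = j then (1 : ℝ) else 0) = d
    generalize hq : 1 + ε * s = q at hQ' ⊢
    generalize hp : r ^ 2 - s = p at hP' ⊢
    field_simp
    subst hq hp
    ring
  · have hquad : ∑ i, ∑ j, ((if i = j then (1 : ℝ) else 0) * (1 + ε * s) ^ 2
        - ε * x i * x j * (2 + ε * r ^ 2 + ε * s)) * x i * x j
        = s * (1 - ε ^ 2 * r ^ 2 * s) := by
      simp [Fin.sum_univ_two, hnorm]
      ring
    calc ∑ i, ∑ j, h i j * W i * W j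
        = ((1 - ε ^ 2 * r ^ 2 * s) / (r ^ 2 * (1 + ε * s) ^ 4)) *
            ((1 + ε * r ^ 2) * (1 + ε * s) / (1 - ε ^ 2 * r ^ 2 * s)) ^ 2 *
            ∑ i, ∑ j, ((if i = j then (1 : ℝ) else 0) * (1 + ε * s) ^ 2
              - ε * x i * x j * (2 + ε * r ^ 2 + ε * s)) * x i * x j := by
          simp only [Finset.mul_sum, hh, hW]
          refine Finset.sum_congr rfl fun i _ => Finset.sum_congr rfl fun j _ => ?_
          ring
      _ = s * (1 + ε * r ^ 2) ^ 2 / (r ^ 2 * (1 + ε * s) ^ 2) := by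
          rw [hquad]
          field_simp
end
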